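/- arXiv:1801.03120 — 3 statements merged into one kernel-verified Lean document; each statement's English description precedes it below -/
import Mathlib

section
/- Let X = {0,1}^ℕ with the product measure μ giving each coordinate the values 0 and 1 with probability 1/2 each, and let T : X → X be the dyadic odometer (addition of 1 with carry in binary). Let q be a real number with 1/2 < |q| < 1, set a = 1/(2q), and define s_q : X → ℝ by s_q(x) = Σ_{i=1}^∞ x_i q^i. For x ∈ X let S_x(j) = Σ_{k=0}^{j-1} s_q(T^k x), extended to real arguments by linear interpolation. Then for μ-almost every x ∈ X there exist a strictly increasing sequence of positive integers (l_n) and positive reals (R_n) such that the functions φ_n(t) = (S_x(t·l_n) − t·S_x(l_n))/R_n converge uniformly on [0,1] to −𝒯_a, where 𝒯_a is the Takagi–Landsberg function with parameter a. -/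
noncomputable section

open MeasureTheory Filter ENNReal

/-- Distance from `x` to the nearest integer. -/
def distInt (x : ℝ) : ℝ := |x - round x|

/-- The Takagi–Landsberg function with parameter `a`:
`𝒯_a(x) = ∑_{n≥0} a^n · dist(2^n x, ℤ)`. -/
def takagi (a : ℝ) (x : ℝ) : ℝ := ∑' n : ℕ, a ^ n * distInt (2 ^ n * x)

/-- The dyadic odometer (addition of `1` with carry) on `{0,1}^ℕ`:
it sends `(1,…,1,0,x_{k+2},…)` to `(0,…,0,1,x_{k+2},…)` and the all-ones
sequence to the all-zeros sequence. -/
def odometer (x : ℕ → Bool) : ℕ → Bool :=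
  fun n => if ∀ i < n, x i = true then !(x n) else x n

/-- `s_q(x) = ∑_{i≥1} x_i q^i` on binary sequences (coordinates indexed from `0`). -/
def sqX (q : ℝ) (x : ℕ → Bool) : ℝ := ∑' i : ℕ, if x i then q ^ (i + 1) else 0

/-- Partial sums `S_x(j) = ∑_{k<j} s_q(T^k x)` along the odometer orbit. -/
def SX (q : ℝ) (x : ℕ → Bool) (j : ℕ) : ℝ :=
  ∑ k ∈ Finset.range j, sqX q (odometer^[k] x)

/-- The partial sums extended to nonnegative real arguments by linear interpolation. -/
def SXr (q : ℝ) (x : ℕ → Bool) (t : ℝ) : ℝ :=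
  SX q x ⌊t⌋₊ + (t - ⌊t⌋₊) * (SX q x (⌊t⌋₊ + 1) - SX q x ⌊t⌋₊)

theorem distInt_nonneg (x : ℝ) : 0 ≤ distInt x := abs_nonneg _

theorem distInt_le_half (x : ℝ) : distInt x ≤ 1 / 2 := abs_sub_round x

theorem continuous_distInt : Continuous distInt := by
  have : distInt = fun x : ℝ => ‖(x : UnitAddCircle)‖ := by
    ext x; rw [UnitAddCircle.norm_eq, distInt]
  rw [this]
  exact continuous_norm.comp (AddCircle.continuous_mk' 1)

theorem distInt_natCast_add (p : ℕ) (y : ℝ) : distInt (p + y) = distInt y := by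
  have h : round ((p : ℝ) + y) = p + round y := by
    simp
  simp [distInt, h]

theorem distInt_natCast (p : ℕ) : distInt p = 0 := by
  simp [distInt]

theorem distInt_of_le_half {y : ℝ} (h0 : 0 ≤ y) (h1 : y ≤ 1 / 2) : distInt y = y := by
  rw [distInt, abs_sub_round_eq_min, Int.fract_eq_self.2 ⟨h0, by linarith⟩]
  exact min_eq_left (by linarith)

theorem distInt_of_half_le {y : ℝ} (h0 : 1 / 2 ≤ y) (h1 : y ≤ 1) : distInt y = 1 - y := by
  rcases h1.eq_or_lt with rfl | h1
  · have := distInt_natCast 1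
    simp_all
  · rw [distInt, abs_sub_round_eq_min, Int.fract_eq_self.2 ⟨by linarith, h1⟩]
    exact min_eq_right (by linarith)

/-- The increment of `distInt` between consecutive multiples of `2 ^ -(i + 1)` is read off from
the `i`-th binary digit. -/
theorem two_pow_mul_distInt_sub (m i : ℕ) :
    2 ^ i * (distInt (((m + 1 : ℕ) : ℝ) / 2 ^ (i + 1)) - distInt ((m : ℝ) / 2 ^ (i + 1))) =
      if m.testBit i then -(1 / 2) else 1 / 2 := by
  have hpos : (0 : ℝ) < 2 ^ i := by positivity
  obtain ⟨p, r, hr, rfl⟩ : ∃ p r, r < 2 ^ (i + 1) ∧ m = 2 ^ (i + 1) * p + r :=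
    ⟨m / 2 ^ (i + 1), m % 2 ^ (i + 1), Nat.mod_lt _ (by positivity), (Nat.div_add_mod _ _).symm⟩
  have e1 : (((2 ^ (i + 1) * p + r + 1 : ℕ) : ℝ) / 2 ^ (i + 1)) =
      p + ((r + 1 : ℕ) : ℝ) / 2 ^ (i + 1) := by
    push_cast; field_simp; ring
  have e2 : (((2 ^ (i + 1) * p + r : ℕ) : ℝ) / 2 ^ (i + 1)) = p + (r : ℝ) / 2 ^ (i + 1) := by
    push_cast; field_simp
  have hbit : (2 ^ (i + 1) * p + r).testBit i = decide (2 ^ i ≤ r) := by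
    rw [Nat.testBit_two_pow_mul_add _ hr]
    simp only [Nat.lt_succ_self, if_true]
    by_cases h : 2 ^ i ≤ r
    · rw [decide_eq_true h, Nat.testBit_of_two_pow_le_and_two_pow_add_one_gt h hr]
    · rw [decide_eq_false h, Nat.testBit_lt_two_pow (not_le.1 h)]
  rw [e1, e2, distInt_natCast_add, distInt_natCast_add, hbit]
  have hp : (2 : ℝ) ^ (i + 1) = 2 * 2 ^ i := by ring
  by_cases h : 2 ^ i ≤ r
  · have h' : (2 : ℝ) ^ i ≤ r := by exact_mod_cast h
    have hr' : ((r + 1 : ℕ) : ℝ) ≤ 2 ^ (i + 1) := by exact_mod_cast hr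
    have hc : ((r + 1 : ℕ) : ℝ) = r + 1 := by push_cast; ring
    rw [distInt_of_half_le, distInt_of_half_le, hc, hp]
    · simp only [h, decide_true, if_true]
      field_simp; ring
    · rw [hp, le_div_iff₀ (by positivity)]; linarith
    · rw [div_le_one (by positivity)]; linarith
    · rw [hp, le_div_iff₀ (by positivity)]; linarith
    · rw [div_le_one (by positivity)]; linarith
  · have h' : ((r + 1 : ℕ) : ℝ) ≤ 2 ^ i := by exact_mod_cast not_le.1 h
    have hc : ((r + 1 : ℕ) : ℝ) = r + 1 := by push_cast; ring
    rw [distInt_of_le_half, distInt_of_le_half, hc, hp]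
    · simp only [h, decide_false, Bool.false_eq_true, if_false]
      field_simp; ring
    · positivity
    · rw [hp, div_le_iff₀ (by positivity)]; linarith
    · positivity
    · rw [hp, div_le_iff₀ (by positivity)]; linarith

theorem testBit_add_one_eq (m i : ℕ) :
    (m + 1).testBit i =
      if ∀ j < i, m.testBit j = true then !(m.testBit i) else m.testBit i := by
  induction i generalizing m with
  | zero =>
    rcases Nat.mod_two_eq_zero_or_one m with h | h <;> simp [Nat.add_mod, h]
  | succ i ih =>
    have hsplit : (∀ j < i + 1, m.testBit j = true) ↔
        m % 2 = 1 ∧ ∀ j < i, (m / 2).testBit j = true := by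
      rw [Nat.forall_lt_succ_left]
      simp [Nat.testBit_succ]
    rw [Nat.testBit_succ, Nat.testBit_succ]
    rcases Nat.mod_two_eq_zero_or_one m with h | h
    · rw [if_neg (by rw [hsplit]; omega), show (m + 1) / 2 = m / 2 by omega]
    · rw [show (m + 1) / 2 = m / 2 + 1 by omega, ih]
      simp only [hsplit, h, true_and]

/-- The odometer adds `1` to the integer encoded by the first `n` digits. -/
theorem odometer_iterate_eq_testBit {n v : ℕ} {x : ℕ → Bool}
    (hx : ∀ i < n, x i = v.testBit i) (k : ℕ) :
    ∀ i < n, (odometer^[k] x) i = (v + k).testBit i := by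
  induction k with
  | zero => simpa using hx
  | succ k ih =>
    intro i hi
    rw [Function.iterate_succ_apply', odometer, ← add_assoc, testBit_add_one_eq, ih i hi]
    have : (∀ j < i, odometer^[k] x j = true) ↔ ∀ j < i, (v + k).testBit j = true :=
      forall₂_congr fun j hj => by rw [ih j (hj.trans hi)]
    simp only [this]

/-- Until a carry out of the first `n` digits occurs, the remaining digits do not change. -/
theorem odometer_iterate_eq_self {n v : ℕ} {x : ℕ → Bool}
    (hx : ∀ i < n, x i = v.testBit i) (k : ℕ) (hk : v + k < 2 ^ n) :
    ∀ i, n ≤ i → (odometer^[k] x) i = x i := by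
  induction k with
  | zero => simp
  | succ k ih =>
    intro i hi
    rw [Function.iterate_succ_apply', odometer, if_neg, ih (by omega) i hi]
    intro h
    have : v + k = 2 ^ n - 1 := by
      apply Nat.eq_of_testBit_eq
      intro j
      rw [Nat.testBit_two_pow_sub_one]
      by_cases hj : j < n
      · rw [← odometer_iterate_eq_testBit hx k j hj, h j (hj.trans_le hi)]; simp [hj]
      · rw [Nat.testBit_lt_two_pow (lt_of_lt_of_le (by omega)
          (Nat.pow_le_pow_right two_pos (not_lt.1 hj)))]
        simp [hj]
    omega

/-- The number of visits to the cylinder `{x i = 1}` along the odometer orbit. -/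
theorem sum_digit_odometer {n v : ℕ} {x : ℕ → Bool}
    (hx : ∀ i < n, x i = v.testBit i) {i : ℕ} (hi : i < n) (c : ℝ) (j : ℕ) :
    ∑ k ∈ Finset.range j, (if (odometer^[k] x) i then c else 0) =
      c * (j / 2 - 2 ^ i * (distInt (((v + j : ℕ) : ℝ) / 2 ^ (i + 1)) -
        distInt ((v : ℝ) / 2 ^ (i + 1)))) := by
  induction j with
  | zero => simp
  | succ j ih =>
    rw [Finset.sum_range_succ, ih, odometer_iterate_eq_testBit hx j i hi]
    have h := two_pow_mul_distInt_sub (v + j) i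
    rw [← add_assoc v j 1]
    have key : ∀ A B D : ℝ, 2 ^ i * (A - B) = (if (v + j).testBit i then -(1 / 2) else 1 / 2) →
        2 ^ i * (A - D) = 2 ^ i * (B - D) + if (v + j).testBit i then -(1 / 2) else 1 / 2 := by
      intro A B D hAB; rw [← hAB]; ring
    rw [key _ _ _ h]
    split_ifs <;> push_cast <;> ring

theorem summable_takagi_bound {a : ℝ} (ha : |a| < 1) : Summable fun n : ℕ => |a| ^ n :=
  summable_geometric_of_lt_one (abs_nonneg a) ha

theorem norm_takagi_term_le (a : ℝ) (n : ℕ) (x : ℝ) :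
    ‖a ^ n * distInt (2 ^ n * x)‖ ≤ |a| ^ n := by
  rw [norm_mul, norm_pow, Real.norm_eq_abs, Real.norm_eq_abs, abs_of_nonneg (distInt_nonneg _)]
  exact mul_le_of_le_one_right (by positivity) ((distInt_le_half _).trans (by norm_num))

theorem continuous_takagi {a : ℝ} (ha : |a| < 1) : Continuous (takagi a) :=
  continuous_tsum
    (fun _ => continuous_const.mul (continuous_distInt.comp (continuous_const.mul continuous_id)))
    (summable_takagi_bound ha) (norm_takagi_term_le a)

theorem tendstoUniformly_takagi {a : ℝ} (ha : |a| < 1) :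
    TendstoUniformly (fun n x => ∑ m ∈ Finset.range n, a ^ m * distInt (2 ^ m * x))
      (takagi a) atTop :=
  tendstoUniformly_tsum_nat (summable_takagi_bound ha) (norm_takagi_term_le a)

theorem takagi_natCast (a : ℝ) (p : ℕ) : takagi a p = 0 := by
  have h : ∀ n : ℕ, distInt (2 ^ n * (p : ℝ)) = 0 := fun n => by
    exact_mod_cast distInt_natCast (2 ^ n * p)
  simp [takagi, h]

theorem norm_digit_term_le (q : ℝ) (x : ℕ → Bool) (n i : ℕ) :
    ‖(if x (i + n) then q ^ (i + n + 1) else 0 : ℝ)‖ ≤ |q| ^ (n + 1) * |q| ^ i := by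
  split_ifs
  · rw [norm_pow, Real.norm_eq_abs, ← pow_add]
    exact le_of_eq (by congr 1; ring)
  · rw [norm_zero]; positivity

theorem sqX_eq_sum_add_tsum {q : ℝ} (hq : |q| < 1) (x : ℕ → Bool) (n : ℕ) :
    sqX q x = ∑ i ∈ Finset.range n, (if x i then q ^ (i + 1) else 0) +
      ∑' i : ℕ, if x (i + n) then q ^ (i + n + 1) else 0 := by
  have : Summable fun i : ℕ => (if x i then q ^ (i + 1) else 0 : ℝ) :=
    Summable.of_norm_bounded
      ((summable_geometric_of_lt_one (abs_nonneg q) hq).mul_left (|q| ^ (0 + 1)))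
      (fun i => norm_digit_term_le q x 0 i)
  exact (this.sum_add_tsum_nat_add n).symm

theorem abs_tsum_digit_le {q : ℝ} (hq : |q| < 1) (x : ℕ → Bool) (n : ℕ) :
    |∑' i : ℕ, if x (i + n) then q ^ (i + n + 1) else 0| ≤ |q| ^ n / (1 - |q|) := by
  have h := tsum_of_norm_bounded
    ((hasSum_geometric_of_lt_one (abs_nonneg q) hq).mul_left (|q| ^ (n + 1)))
    (norm_digit_term_le q x n)
  rw [Real.norm_eq_abs] at h
  refine h.trans ?_
  have h1 : 0 < 1 - |q| := by linarith
  rw [div_eq_mul_inv]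
  gcongr ?_ * _
  exact pow_le_pow_of_le_one (abs_nonneg q) hq.le (Nat.le_succ n)

/-- Up to a linear term, the partial sums over at most `2 ^ n` iterates are given by the digits
below `n`, with an error controlled by the integer `v` encoding the first `n` digits. -/
theorem exists_abs_SX_sub_le {q : ℝ} (hq : |q| < 1) {n v : ℕ} {x : ℕ → Bool}
    (hx : ∀ i < n, x i = v.testBit i) (hv : v ≤ 2 ^ n) :
    ∃ c : ℝ, ∀ j ≤ 2 ^ n,
      |SX q x j - j * c + ∑ i ∈ Finset.range n, q ^ (i + 1) * (2 ^ i *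
        (distInt (((v + j : ℕ) : ℝ) / 2 ^ (i + 1)) - distInt ((v : ℝ) / 2 ^ (i + 1))))| ≤
      v * (2 * (|q| ^ n / (1 - |q|))) := by
  set tail : (ℕ → Bool) → ℝ :=
    fun y => ∑' i : ℕ, if y (i + n) then q ^ (i + n + 1) else 0 with htail
  refine ⟨∑ i ∈ Finset.range n, q ^ (i + 1) / 2 + tail x, fun j hj => ?_⟩
  have hS : SX q x j = ∑ i ∈ Finset.range n, q ^ (i + 1) * (j / 2 - 2 ^ i *
      (distInt (((v + j : ℕ) : ℝ) / 2 ^ (i + 1)) - distInt ((v : ℝ) / 2 ^ (i + 1)))) +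
      ∑ k ∈ Finset.range j, tail (odometer^[k] x) := by
    simp only [SX, sqX_eq_sum_add_tsum hq _ n, Finset.sum_add_distrib]
    rw [Finset.sum_comm]
    congr 1
    exact Finset.sum_congr rfl fun i hi => sum_digit_odometer hx (Finset.mem_range.1 hi) _ j
  have hE : SX q x j - j * (∑ i ∈ Finset.range n, q ^ (i + 1) / 2 + tail x) +
      ∑ i ∈ Finset.range n, q ^ (i + 1) * (2 ^ i *
        (distInt (((v + j : ℕ) : ℝ) / 2 ^ (i + 1)) - distInt ((v : ℝ) / 2 ^ (i + 1)))) =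
      ∑ k ∈ Finset.range j, (tail (odometer^[k] x) - tail x) := by
    rw [hS, Finset.sum_sub_distrib, Finset.sum_const, Finset.card_range, nsmul_eq_mul]
    simp only [mul_sub (q ^ _), Finset.sum_sub_distrib]
    rw [mul_add, Finset.mul_sum,
      Finset.sum_congr rfl fun i _ => (by ring : q ^ (i + 1) * ((j : ℝ) / 2) =
        j * (q ^ (i + 1) / 2))]
    ring
  rw [hE]
  calc |∑ k ∈ Finset.range j, (tail (odometer^[k] x) - tail x)|
      ≤ ∑ k ∈ Finset.range j, |tail (odometer^[k] x) - tail x| :=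
        Finset.abs_sum_le_sum_abs _ _
    _ ≤ ∑ k ∈ Finset.range (2 ^ n - v + v), |tail (odometer^[k] x) - tail x| :=
        Finset.sum_le_sum_of_subset_of_nonneg (Finset.range_mono (by omega))
          fun _ _ _ => abs_nonneg _
    _ = ∑ k ∈ Finset.range v, |tail (odometer^[2 ^ n - v + k] x) - tail x| := by
        rw [Finset.sum_range_add, Finset.sum_eq_zero, zero_add]
        intro k hk
        have hk' := Finset.mem_range.1 hk
        have : tail (odometer^[k] x) = tail x := by
          simp only [htail]
          exact tsum_congr fun i => by
            rw [odometer_iterate_eq_self hx k (by omega) (i + n) (by omega)]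
        rw [this, sub_self, abs_zero]
    _ ≤ ∑ k ∈ Finset.range v, 2 * (|q| ^ n / (1 - |q|)) := by
        refine Finset.sum_le_sum fun k _ => (abs_sub _ _).trans ?_
        have h1 := abs_tsum_digit_le hq (odometer^[2 ^ n - v + k] x) n
        have h2 := abs_tsum_digit_le hq x n
        linarith
    _ = _ := by simp

theorem sum_digits_eq_takagi_partial {q a : ℝ} (hq : q ≠ 0) (ha : a = 1 / (2 * q)) (n : ℕ)
    (u : ℝ) :
    ∑ i ∈ Finset.range n, q ^ (i + 1) * (2 ^ i * distInt (u / 2 ^ (i + 1))) =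
      (2 * q) ^ n / 2 * ∑ m ∈ Finset.range n, a ^ m * distInt (2 ^ m * (u / 2 ^ n)) := by
  rw [← Finset.sum_range_reflect, Finset.mul_sum]
  refine Finset.sum_congr rfl fun m hm => ?_
  obtain ⟨p, rfl⟩ : ∃ p, n = m + p + 1 := ⟨n - m - 1, by have := Finset.mem_range.1 hm; omega⟩
  have e : m + p + 1 - 1 - m = p := by omega
  have e2 : (2 : ℝ) ^ m * (u / 2 ^ (m + p + 1)) = u / 2 ^ (p + 1) := by
    rw [add_assoc, pow_add]; field_simp
  rw [e, e2, ha]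
  have e3 : (2 * q) ^ (m + p + 1) / 2 * (1 / (2 * q)) ^ m = q ^ (p + 1) * 2 ^ p := by
    rw [add_assoc, pow_add, one_div, inv_pow, mul_pow 2 q (p + 1)]
    field_simp
    ring
  rw [← mul_assoc, ← mul_assoc, e3]

/-- Rescaled version of `exists_abs_SX_sub_le`, with partial sums of the Takagi series. -/
theorem exists_abs_SX_div_sub_le {q a : ℝ} (hq0 : q ≠ 0) (hq : |q| < 1) (ha : a = 1 / (2 * q))
    {n v : ℕ} (hn : Even n) {x : ℕ → Bool}
    (hx : ∀ i < n, x i = v.testBit i) (hv : v ≤ 2 ^ n) :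
    ∃ c : ℝ, ∀ j ≤ 2 ^ n,
      |SX q x j / ((2 * q) ^ n / 2) - j * c +
        (∑ m ∈ Finset.range n, a ^ m * distInt (2 ^ m * (((v + j : ℕ) : ℝ) / 2 ^ n)) -
          ∑ m ∈ Finset.range n, a ^ m * distInt (2 ^ m * ((v : ℝ) / 2 ^ n)))| ≤
      (v : ℝ) / 2 ^ n * (4 / (1 - |q|)) := by
  obtain ⟨c, hc⟩ := exists_abs_SX_sub_le hq hx hv
  have hR : 0 < (2 * q) ^ n / 2 := div_pos (hn.pow_pos (by simpa using hq0)) two_pos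
  refine ⟨c / ((2 * q) ^ n / 2), fun j hj => ?_⟩
  have h := hc j hj
  simp only [mul_sub, Finset.sum_sub_distrib] at h
  rw [sum_digits_eq_takagi_partial hq0 ha, sum_digits_eq_takagi_partial hq0 ha] at h
  rw [← mul_le_mul_iff_of_pos_left hR]
  calc _ = |(2 * q) ^ n / 2 * (SX q x j / ((2 * q) ^ n / 2) - j * (c / ((2 * q) ^ n / 2)) +
        (∑ m ∈ Finset.range n, a ^ m * distInt (2 ^ m * (((v + j : ℕ) : ℝ) / 2 ^ n)) -
          ∑ m ∈ Finset.range n, a ^ m * distInt (2 ^ m * ((v : ℝ) / 2 ^ n))))| := by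
        rw [abs_mul, abs_of_pos hR]
    _ = _ := by
        have key : ∀ r s b d A B : ℝ, r ≠ 0 →
            r * (s / r - b * (d / r) + (A - B)) = s - b * d + (r * A - r * B) := by
          intro r s b d A B hr; field_simp
        rw [key _ _ _ _ _ _ hR.ne']
    _ ≤ _ := h
    _ = _ := by
        rw [mul_pow, ← hn.pow_abs q]
        field_simp
        ring

/-- The linear interpolation stays within any bound satisfied at the two neighbouring integers. -/
theorem abs_SXr_div_sub_add_le {q R c w B u : ℝ} {x : ℕ → Bool} {L : ℕ}
    (hu0 : 0 ≤ u) (huL : u ≤ L)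
    (h : ∀ j ≤ L, |(j : ℝ) - u| ≤ 1 → |SX q x j / R - j * c + w| ≤ B) :
    |SXr q x u / R - u * c + w| ≤ B := by
  have hm1 : (⌊u⌋₊ : ℝ) ≤ u := Nat.floor_le hu0
  have hm2 : u < ⌊u⌋₊ + 1 := Nat.lt_floor_add_one u
  have hmL : ⌊u⌋₊ ≤ L := by exact_mod_cast hm1.trans huL
  have h0 := h ⌊u⌋₊ hmL (by rw [abs_le]; constructor <;> linarith)
  rcases hm1.eq_or_lt with he | hlt
  · have : SXr q x u = SX q x ⌊u⌋₊ := by rw [SXr, he, sub_self, zero_mul, add_zero]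
    rwa [this, ← he, Nat.floor_natCast]
  · have hmL' : ⌊u⌋₊ + 1 ≤ L := by
      have : (⌊u⌋₊ : ℝ) < L := hlt.trans_le huL
      exact_mod_cast this
    have h1 := h (⌊u⌋₊ + 1) hmL' (by push_cast; rw [abs_le]; constructor <;> linarith)
    have e : SXr q x u / R - u * c + w =
        (1 - (u - ⌊u⌋₊)) * (SX q x ⌊u⌋₊ / R - ⌊u⌋₊ * c + w) +
        (u - ⌊u⌋₊) * (SX q x (⌊u⌋₊ + 1) / R - ((⌊u⌋₊ + 1 : ℕ) : ℝ) * c + w) := by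
      rw [SXr]; push_cast; ring
    rw [abs_le] at h0 h1
    rw [e, abs_le]
    have hs0 : 0 ≤ 1 - (u - ⌊u⌋₊) := by linarith
    have hs1 : 0 ≤ u - ⌊u⌋₊ := by linarith
    constructor <;>
    nlinarith [mul_le_mul_of_nonneg_left h0.1 hs0, mul_le_mul_of_nonneg_left h0.2 hs0,
      mul_le_mul_of_nonneg_left h1.1 hs1, mul_le_mul_of_nonneg_left h1.2 hs1]

theorem exists_testBit_eq_of_eq_false (x : ℕ → Bool) {k n : ℕ}
    (hx : ∀ i, n - k ≤ i → i < n → x i = false) :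
    ∃ v < 2 ^ (n - k), ∀ i < n, x i = v.testBit i := by
  refine ⟨Nat.ofBits fun i : Fin (n - k) => x i, Nat.ofBits_lt_two_pow _, fun i hi => ?_⟩
  by_cases h : i < n - k
  · rw [Nat.testBit_ofBits_lt _ _ h]
  · rw [Nat.testBit_ofBits_ge _ _ (not_lt.1 h), hx i (not_lt.1 h) hi]

/-- If the digits in positions `n - k, …, n - 1` vanish, then the normalized partial sums over
`2 ^ n` iterates are close to the Takagi–Landsberg function once `k` is large. -/
theorem exists_abs_normalized_add_takagi_lt {q a : ℝ} (hq : 1 / 2 < |q|) (hq1 : |q| < 1)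
    (ha : a = 1 / (2 * q)) (x : ℕ → Bool) {ε : ℝ} (hε : 0 < ε) :
    ∃ K : ℕ, ∀ k n, K ≤ k → k ≤ n → Even n → (∀ i, n - k ≤ i → i < n → x i = false) →
      ∀ t ∈ Set.Icc (0 : ℝ) 1,
        |(SXr q x (t * (2 ^ n : ℕ)) - t * SXr q x (2 ^ n : ℕ)) / ((2 * q) ^ n / 2) +
          takagi a t| < ε := by
  have hq0 : q ≠ 0 := by rintro rfl; norm_num at hq
  have ha1 : |a| < 1 := by
    rw [ha, abs_div, abs_one, abs_mul, abs_two, div_lt_one (by linarith)]; linarith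
  set η := ε / 20 with hη
  have hη0 : 0 < η := by positivity
  obtain ⟨δ, hδ, hT⟩ := Metric.uniformContinuousOn_iff.1
    ((isCompact_Icc (a := (0 : ℝ)) (b := 2)).uniformContinuousOn_of_continuous
      (continuous_takagi ha1).continuousOn) η hη0
  obtain ⟨N, hN⟩ := eventually_atTop.1
    (Metric.tendstoUniformly_iff.1 (tendstoUniformly_takagi ha1) η hη0)
  have hlim : Tendsto (fun k : ℕ => (1 / 2 : ℝ) ^ k) atTop (nhds 0) :=
    tendsto_pow_atTop_nhds_zero_of_lt_one (by norm_num) (by norm_num)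
  set M := 4 / (1 - |q|) with hM
  have hM0 : 0 < M := div_pos (by norm_num) (by linarith)
  obtain ⟨K, hK⟩ := eventually_atTop.1
    ((hlim.eventually (gt_mem_nhds (half_pos hδ))).and
      (hlim.eventually (gt_mem_nhds (div_pos hη0 hM0))))
  refine ⟨max K N, fun k n hk hkn hn hx => ?_⟩
  obtain ⟨v, hv, hxv⟩ := exists_testBit_eq_of_eq_false x hx
  have hv2 : v ≤ 2 ^ n := hv.le.trans (Nat.pow_le_pow_right two_pos (Nat.sub_le n k))
  obtain ⟨c, hc⟩ := exists_abs_SX_div_sub_le hq0 hq1 ha hn hxv hv2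
  obtain ⟨hk1, hk2⟩ := hK k (le_trans (le_max_left _ _) hk)
  have hPn := hN n ((le_trans (le_max_right _ _) hk).trans hkn)
  have hL : (0 : ℝ) < 2 ^ n := by positivity
  have hvL : (v : ℝ) / 2 ^ n ≤ (1 / 2) ^ k := by
    have h1 : (v : ℝ) ≤ 2 ^ (n - k) := by exact_mod_cast hv.le
    rw [div_le_iff₀ hL]
    refine h1.trans (le_of_eq ?_)
    rw [← Nat.sub_add_cancel hkn, Nat.add_sub_cancel, pow_add, one_div, inv_pow]
    field_simp
  have hvL0 : 0 ≤ (v : ℝ) / 2 ^ n := by positivity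
  have hvL1 : (v : ℝ) / 2 ^ n ≤ 1 := by
    rw [div_le_one hL]; exact_mod_cast hv2
  have hnL : 1 / (2 : ℝ) ^ n ≤ (1 / 2) ^ k := by
    rw [← one_div_pow]
    exact pow_le_pow_of_le_one (by norm_num) (by norm_num) hkn
  have hErr : (v : ℝ) / 2 ^ n * M ≤ η :=
    ((mul_le_mul_of_nonneg_right hvL hM0.le).trans_lt ((lt_div_iff₀ hM0).1 hk2)).le
  have hT0 : takagi a 0 = 0 := by exact_mod_cast takagi_natCast a 0
  have hT1 : takagi a 1 = 0 := by exact_mod_cast takagi_natCast a 1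
  have main : ∀ t ∈ Set.Icc (0 : ℝ) 1,
      |SXr q x (t * (2 ^ n : ℕ)) / ((2 * q) ^ n / 2) - t * (2 ^ n : ℕ) * c + takagi a t| ≤
        5 * η := by
    intro t ht
    have hcast : ((2 ^ n : ℕ) : ℝ) = 2 ^ n := by push_cast; rfl
    refine abs_SXr_div_sub_add_le (L := 2 ^ n) (mul_nonneg ht.1 (by positivity))
      (mul_le_of_le_one_left (by positivity) ht.2) fun j hj hjt => ?_
    have hjL : (j : ℝ) / 2 ^ n ≤ 1 := by
      rw [div_le_one hL]; exact_mod_cast hj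
    have hjL0 : 0 ≤ (j : ℝ) / 2 ^ n := by positivity
    have hsum : ((v + j : ℕ) : ℝ) / 2 ^ n = (v : ℝ) / 2 ^ n + (j : ℝ) / 2 ^ n := by
      push_cast; ring
    have hclose : |(j : ℝ) / 2 ^ n - t| ≤ 1 / 2 ^ n := by
      rw [hcast] at hjt
      have e : (j : ℝ) / 2 ^ n - t = (j - t * 2 ^ n) / 2 ^ n := by field_simp
      rw [e, abs_div, abs_of_pos hL]
      gcongr
    have h1 := hc j hj
    have h2 := hPn (((v + j : ℕ) : ℝ) / 2 ^ n)
    have h3 := hPn ((v : ℝ) / 2 ^ n)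
    have h4 : dist (takagi a (((v + j : ℕ) : ℝ) / 2 ^ n)) (takagi a t) < η := by
      refine hT _ ⟨by positivity, by linarith⟩ _ ⟨ht.1, by linarith [ht.2]⟩ ?_
      rw [hsum, Real.dist_eq]
      rw [abs_le] at hclose
      rw [abs_lt]
      constructor <;> linarith [hclose.1, hclose.2]
    have h5 : dist (takagi a ((v : ℝ) / 2 ^ n)) (takagi a 0) < η := by
      refine hT _ ⟨by positivity, by linarith⟩ _ ⟨le_rfl, by norm_num⟩ ?_
      rw [Real.dist_eq, sub_zero, abs_of_nonneg hvL0]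
      linarith
    rw [hT0] at h5
    rw [Real.dist_eq, abs_lt] at h2 h3 h4 h5
    rw [abs_le] at h1 ⊢
    constructor <;> linarith [h1.1, h1.2, h2.1, h2.2, h3.1, h3.2, h4.1, h4.2, h5.1, h5.2]
  intro t ht
  have hA := main t ht
  have hB := main 1 ⟨zero_le_one, le_rfl⟩
  rw [hT1, add_zero, one_mul] at hB
  have e : (SXr q x (t * (2 ^ n : ℕ)) - t * SXr q x (2 ^ n : ℕ)) / ((2 * q) ^ n / 2) +
      takagi a t =
      (SXr q x (t * (2 ^ n : ℕ)) / ((2 * q) ^ n / 2) - t * (2 ^ n : ℕ) * c + takagi a t) -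
      t * (SXr q x (2 ^ n : ℕ) / ((2 * q) ^ n / 2) - (2 ^ n : ℕ) * c) := by ring
  have hB' : |t * (SXr q x (2 ^ n : ℕ) / ((2 * q) ^ n / 2) - (2 ^ n : ℕ) * c)| ≤ 5 * η := by
    rw [abs_mul, abs_of_nonneg ht.1]
    exact (mul_le_of_le_one_left (abs_nonneg _) ht.2).trans hB
  rw [e]
  refine (abs_sub _ _).trans_lt ?_
  linarith

/-- Almost every sequence has, for a given `k`, blocks of at least `k` zeros ending at arbitrarily
large even positions. -/
theorem ae_frequently_zero_block (μ : Measure (ℕ → Bool)) [IsProbabilityMeasure μ]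
    (hμ : ∀ (s : Finset ℕ) (f : ℕ → Bool),
      μ {x | ∀ i ∈ s, x i = f i} = (1 / 2 : ℝ≥0∞) ^ s.card) (k : ℕ) :
    ∀ᵐ x ∂μ, ∃ᶠ n in atTop, Even n ∧ k ≤ n ∧ ∀ i, n - k ≤ i → i < n → x i = false := by
  set d := 2 * (k + 1) with hd
  set blk : ℕ → Finset ℕ := fun r => Finset.Ico (d * r) (d * (r + 1)) with hblk
  set A : ℕ → Set (ℕ → Bool) := fun r => {x | ∀ i ∈ blk r, x i = false} with hA
  have hcard : ∀ r, (blk r).card = d := fun r => by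
    simp only [hblk, Nat.card_Ico, Nat.mul_succ]; omega
  have hdisj : ∀ r s, r ≠ s → Disjoint (blk r) (blk s) := by
    intro r s hrs
    rw [Finset.disjoint_left]
    intro i hi hj
    simp only [hblk, Finset.mem_Ico] at hi hj
    have hd0 : 0 < d := by omega
    have h1 := Nat.lt_of_mul_lt_mul_left (hi.1.trans_lt hj.2)
    have h2 := Nat.lt_of_mul_lt_mul_left (hj.1.trans_lt hi.2)
    omega
  have hmeas : ∀ r, MeasurableSet (A r) := by
    intro r
    have : A r = ⋂ i ∈ blk r, (fun x : ℕ → Bool => x i) ⁻¹' {false} := by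
      ext x; simp [hA]
    rw [this]
    exact Finset.measurableSet_biInter _ fun i _ =>
      measurable_pi_apply i (measurableSet_singleton false)
  have hmA : ∀ r, μ (A r) = (1 / 2 : ℝ≥0∞) ^ d := fun r => by
    rw [← hcard r]; exact hμ (blk r) fun _ => false
  have hindep : ProbabilityTheory.iIndepSet A μ := by
    rw [ProbabilityTheory.iIndepSet_iff_meas_biInter hmeas]
    intro s
    have : ⋂ r ∈ s, A r = {x | ∀ i ∈ s.biUnion blk, x i = false} := by
      ext x
      simp only [hA, Set.mem_iInter, Set.mem_ofPred_eq, Finset.mem_biUnion]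
      exact ⟨fun h i ⟨r, hr, hi⟩ => h r hr i hi, fun h r hr i hi => h i ⟨r, hr, hi⟩⟩
    rw [this, hμ (s.biUnion blk) fun _ => false,
      Finset.card_biUnion fun r _ t _ hrt => hdisj r t hrt]
    simp only [hcard, hmA, Finset.sum_const, Finset.prod_const, smul_eq_mul]
    rw [← pow_mul, mul_comm]
  have hsum : ∑' r, μ (A r) = ∞ := by
    simp only [hmA]
    exact ENNReal.tsum_const_eq_top_of_ne_zero (by simp)
  have hone := ProbabilityTheory.measure_limsup_eq_one hmeas hindep hsum
  have hae := (mem_ae_iff_prob_eq_one (MeasurableSet.measurableSet_limsup hmeas)).2 hone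
  filter_upwards [hae] with x hx
  rw [mem_limsup_iff_frequently_mem, frequently_atTop] at hx
  rw [frequently_atTop]
  intro b
  obtain ⟨r, hr, hxr⟩ := hx b
  have hdr : d * (r + 1) = d * r + d := Nat.mul_succ d r
  have hrd : r ≤ d * r := Nat.le_mul_of_pos_left r (by omega)
  refine ⟨d * (r + 1), by omega, ⟨(k + 1) * (r + 1), by rw [hd]; ring⟩, by omega,
    fun i hi1 hi2 => hxr i (Finset.mem_Ico.2 ⟨by omega, hi2⟩)⟩

/-- For the dyadic odometer with the `(1/2,1/2)` Bernoulli measure `μ`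
(characterized by its values on cylinder sets) and `1/2 < |q| < 1`,
for `μ`-a.e. `x` there are a strictly increasing stabilizing sequence `l n` of
positive integers and positive normalizing constants `R n` such that
`t ↦ (S_x(t·l_n) − t·S_x(l_n))/R_n` converges uniformly on `[0,1]`
to `−𝒯_a` where `a = 1/(2q)`. -/
theorem limiting_curve_dyadic_odometer
    (q : ℝ) (hq : 1 / 2 < |q|) (hq1 : |q| < 1) (a : ℝ) (ha : a = 1 / (2 * q))
    (μ : Measure (ℕ → Bool)) [IsProbabilityMeasure μ]
    (hμ : ∀ (s : Finset ℕ) (f : ℕ → Bool),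
      μ {x | ∀ i ∈ s, x i = f i} = (1 / 2 : ℝ≥0∞) ^ s.card) :
    ∀ᵐ x ∂μ, ∃ l : ℕ → ℕ, StrictMono l ∧ (∀ n, 0 < l n) ∧
      ∃ R : ℕ → ℝ, (∀ n, 0 < R n) ∧
        TendstoUniformlyOn
          (fun n t => (SXr q x (t * l n) - t * SXr q x (l n)) / R n)
          (fun t => -takagi a t) atTop (Set.Icc (0:ℝ) 1) := by
  have hq0 : q ≠ 0 := by rintro rfl; norm_num at hq
  filter_upwards [ae_all_iff.2 (ae_frequently_zero_block μ hμ)] with x hx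
  obtain ⟨φ, hφ, hφx⟩ := extraction_forall_of_frequently hx
  refine ⟨fun n => 2 ^ φ n, fun m n h => Nat.pow_lt_pow_right one_lt_two (hφ h),
    fun n => by positivity, fun n => (2 * q) ^ φ n / 2,
    fun n => div_pos ((hφx n).1.pow_pos (by simpa using hq0)) two_pos, ?_⟩
  rw [Metric.tendstoUniformlyOn_iff]
  intro ε hε
  obtain ⟨K, hK⟩ := exists_abs_normalized_add_takagi_lt hq hq1 ha x hε
  filter_upwards [eventually_ge_atTop K] with n hn t ht
  rw [dist_comm, Real.dist_eq, sub_neg_eq_add]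
  exact hK n (φ n) hn (hφx n).2.1 (hφx n).1 (hφx n).2.2 t ht

end
end

section
/- Let q be a real number with |q| > 1/2 and set a = 1/(2q). Then for every integer n ≥ 1, with k_n = ⌊log₂ n⌋ and x_n = n/2^{k_n} − 1 ∈ [0,1), the following exact generalized Trollope–Delange formula holds: S_q(n) = (2q)^{k_n} ( q·x_n − (1/2)·𝒯_a(x_n) ) + (n/2)·Σ_{i=1}^{k_n} q^i. -/
noncomputable section

open MeasureTheory Filter Finset

/-- Weighted sum-of-binary-digits function: for `j = ∑ ω_i 2^i`,
`s_q(j) = ∑ ω_i q^{i+1}`. -/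
def sqN (q : ℝ) (j : ℕ) : ℝ := ∑ i ∈ Finset.range j, if j.testBit i then q ^ (i + 1) else 0

/-- `S_q(n) = ∑_{j<n} s_q(j)`. -/
def Sq (q : ℝ) (n : ℕ) : ℝ := ∑ j ∈ Finset.range n, sqN q j

theorem distInt_sub_int (x : ℝ) (m : ℤ) : distInt (x - m) = distInt x := by
  simp [distInt, abs_sub_round_eq_min]

theorem distInt_intCast (m : ℤ) : distInt m = 0 := by
  simp [distInt]

theorem distInt_natCast_div (n m : ℕ) :
    distInt ((n : ℝ) / m) = min (((n % m : ℕ) : ℝ) / m) (1 - ((n % m : ℕ) : ℝ) / m) := by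
  rw [distInt, abs_sub_round_eq_min, Int.fract_div_natCast_eq_div_natCast_mod]

theorem mul_distInt_div_two_mul {M : ℕ} (hM : 0 < M) (n : ℕ) :
    (M : ℝ) * distInt ((n : ℝ) / (2 * M : ℕ)) =
      min (((n % (2 * M) : ℕ) : ℝ) / 2) (M - ((n % (2 * M) : ℕ) : ℝ) / 2) := by
  have hM' : (0 : ℝ) < M := by exact_mod_cast hM
  rw [distInt_natCast_div, mul_min_of_nonneg _ _ hM'.le]
  congr 1 <;> push_cast <;> field_simp

/-- The number of `j < n` whose quotient by `M` is odd. -/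
theorem sum_ite_div_mod_two {M : ℕ} (hM : 0 < M) (n : ℕ) :
    ∑ j ∈ range n, (if j / M % 2 = 1 then (1 : ℝ) else 0) =
      n / 2 - M * distInt ((n : ℝ) / (2 * M : ℕ)) := by
  have hM' : (0 : ℝ) < M := by exact_mod_cast hM
  induction n with
  | zero => simp [distInt]
  | succ n ih =>
    rw [sum_range_succ, ih, mul_distInt_div_two_mul hM, mul_distInt_div_two_mul hM]
    have hr : n % (2 * M) < 2 * M := Nat.mod_lt _ (by omega)
    have hbit : n / M % 2 = 1 ↔ M ≤ n % (2 * M) := by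
      have hdecomp : n % (2 * M) = n % M + M * (n / M % 2) := by
        rw [mul_comm 2 M, Nat.mod_mul]
      have hlt : n % M < M := Nat.mod_lt _ hM
      rcases Nat.mod_two_eq_zero_or_one (n / M) with h | h <;> rw [h] at hdecomp <;> omega
    simp only [hbit]
    have hsucc : (n + 1) % (2 * M) = if n % (2 * M) + 1 = 2 * M then 0 else n % (2 * M) + 1 := by
      rw [Nat.add_mod_eq_ite, Nat.mod_eq_of_lt (show 1 < 2 * M by omega)]
      split_ifs <;> omega
    rw [hsucc]
    generalize n % (2 * M) = r at hr ⊢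
    by_cases hlast : r + 1 = 2 * M
    · have hcast : (r : ℝ) + 1 = 2 * M := by exact_mod_cast hlast
      have h1 : (1 : ℝ) ≤ M := by exact_mod_cast hM
      rw [if_pos (by omega), if_pos hlast, min_eq_right (by linarith), min_eq_left (by simp)]
      push_cast
      linarith
    · rw [if_neg hlast]
      by_cases hle : M ≤ r
      · have hcast : (M : ℝ) ≤ r := by exact_mod_cast hle
        rw [if_pos hle, min_eq_right (by linarith), min_eq_right (by push_cast; linarith)]
        push_cast
        ring
      · have hcast : (r : ℝ) + 1 ≤ M := by exact_mod_cast not_le.mp hle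
        rw [if_neg hle, min_eq_left (by linarith), min_eq_left (by push_cast; linarith)]
        push_cast
        ring

/-- The number of `j < n` whose `i`-th binary digit is one. -/
theorem sum_ite_testBit (i n : ℕ) :
    ∑ j ∈ range n, (if j.testBit i then (1 : ℝ) else 0) =
      n / 2 - 2 ^ i * distInt ((n : ℝ) / 2 ^ (i + 1)) := by
  have h := sum_ite_div_mod_two (Nat.two_pow_pos i) n
  simpa [Nat.testBit_eq_decide_div_mod_eq, pow_succ'] using h

theorem sqN_eq_sum_range (q : ℝ) {j K : ℕ} (hj : j < 2 ^ K) :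
    sqN q j = ∑ i ∈ range K, if j.testBit i then q ^ (i + 1) else 0 := by
  have hzero : ∀ i, j < 2 ^ i → (if j.testBit i then q ^ (i + 1) else 0) = 0 := fun i hi => by
    simp [Nat.testBit_lt_two_pow hi]
  rcases le_total j K with h | h
  · refine sum_subset (range_subset_range.2 h) fun i _ hi => hzero i ?_
    exact (Nat.lt_two_pow_self).trans_le
      (Nat.pow_le_pow_right two_pos (not_lt.mp (mem_range.not.mp hi)))
  · refine (sum_subset (range_subset_range.2 h) fun i _ hi => hzero i ?_).symm
    exact hj.trans_le (Nat.pow_le_pow_right two_pos (not_lt.mp (mem_range.not.mp hi)))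

theorem Sq_eq_sum_distInt (q : ℝ) {n K : ℕ} (hn : n ≤ 2 ^ K) :
    Sq q n = ∑ i ∈ range K, q ^ (i + 1) * (n / 2 - 2 ^ i * distInt ((n : ℝ) / 2 ^ (i + 1))) := by
  have h : Sq q n = ∑ j ∈ range n, ∑ i ∈ range K, if j.testBit i then q ^ (i + 1) else 0 :=
    sum_congr rfl fun j hj => sqN_eq_sum_range q ((mem_range.mp hj).trans_le hn)
  rw [h, sum_comm]
  refine sum_congr rfl fun i _ => ?_
  rw [← sum_ite_testBit, mul_sum]
  simp

theorem takagi_eq_sum_range (a : ℝ) {x : ℝ} {k : ℕ} {m : ℤ} (hx : 2 ^ k * x = m) :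
    takagi a x = ∑ j ∈ range k, a ^ j * distInt (2 ^ j * x) := by
  refine tsum_eq_sum fun j hj => ?_
  obtain ⟨d, rfl⟩ := Nat.exists_eq_add_of_le (not_lt.mp (mem_range.not.mp hj))
  have h : (2 : ℝ) ^ (k + d) * x = ((2 ^ d * m : ℤ) : ℝ) := by
    push_cast
    rw [← hx]
    ring
  rw [h, distInt_intCast, mul_zero]

theorem generalized_trollope_delange (q : ℝ) (hq : 1 / 2 < |q|) (a : ℝ) (ha : a = 1 / (2 * q))
    (n : ℕ) (hn : 1 ≤ n) (k : ℕ) (hk : k = Nat.log 2 n)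
    (x : ℝ) (hx : x = (n : ℝ) / (2 ^ k : ℝ) - 1) :
    Sq q n = (2 * q) ^ k * (q * x - (1 / 2) * takagi a x)
      + ((n : ℝ) / 2) * (∑ i ∈ Finset.Icc 1 k, q ^ i) := by
  have hq0 : q ≠ 0 := by
    rintro rfl
    norm_num at hq
  have hlow : 2 ^ k ≤ n := hk ▸ Nat.pow_log_le_self 2 (by omega)
  have hhigh : n < 2 ^ (k + 1) := hk ▸ Nat.lt_pow_succ_log_self (by norm_num) n
  have hnx : (n : ℝ) = 2 ^ k * (1 + x) := by
    rw [hx]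
    field_simp
    ring
  have hint : 2 ^ k * x = (((n : ℤ) - 2 ^ k : ℤ) : ℝ) := by
    push_cast
    linarith
  have htop : (2 : ℝ) ^ k * distInt ((n : ℝ) / 2 ^ (k + 1)) = 2 ^ k - n / 2 := by
    have hlow' : (2 : ℝ) ^ k ≤ n := by exact_mod_cast hlow
    have h := mul_distInt_div_two_mul (Nat.two_pow_pos k) n
    rw [← pow_succ', Nat.mod_eq_of_lt hhigh] at h
    push_cast at h
    rw [h, min_eq_right (by linarith)]
  have hterm : ∀ j ∈ range k,
      q ^ (k - 1 - j + 1) * (2 ^ (k - 1 - j) * distInt ((n : ℝ) / 2 ^ (k - 1 - j + 1))) =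
        (2 * q) ^ k * (1 / 2) * (a ^ j * distInt (2 ^ j * x)) := by
    intro j hj
    obtain ⟨d, rfl⟩ : ∃ d, k = j + d + 1 := ⟨k - 1 - j, by have := mem_range.mp hj; omega⟩
    have hd : j + d + 1 - 1 - j = d := by omega
    have hdist : distInt ((n : ℝ) / 2 ^ (d + 1)) = distInt (2 ^ j * x) := by
      rw [← distInt_sub_int _ (2 ^ j)]
      congr 1
      rw [hnx]
      push_cast
      field_simp
      ring
    rw [hd, hdist, ha, one_div_pow, mul_pow, mul_pow]
    field_simp
    ring
  have hIcc : ∑ i ∈ Icc 1 k, q ^ i = ∑ i ∈ range k, q ^ (i + 1) := by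
    rw [range_eq_Ico, sum_Ico_add' (fun i => q ^ i) 0 k 1]
    rfl
  have hsum : ∑ i ∈ range k, q ^ (i + 1) * (2 ^ i * distInt ((n : ℝ) / 2 ^ (i + 1))) =
      (2 * q) ^ k * (1 / 2) * takagi a x := by
    rw [takagi_eq_sum_range a hint, mul_sum, ← sum_range_reflect, sum_congr rfl hterm]
  rw [Sq_eq_sum_distInt q hhigh.le, sum_range_succ, htop]
  simp only [mul_sub, sum_sub_distrib]
  rw [hsum, hIcc, ← sum_mul, hnx]
  ring

end
end

section
/- Let q be a real number. Then for every integer k ≥ 1: S_q(2^k) = 2^{k−1}·(q + q² + ⋯ + q^k) = 2^{k−1}·Σ_{i=1}^{k} q^i. In particular, if q ≠ 1 then S_q(2^k) = 2^{k−1}·q·(1 − q^k)/(1 − q). -/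
noncomputable section

open MeasureTheory Filter Finset

theorem sqN_eq_sum_range_of_lt_two_pow (q : ℝ) {j m : ℕ} (h : j < 2 ^ m) :
    sqN q j = ∑ i ∈ Finset.range m, if j.testBit i then q ^ (i + 1) else 0 := by
  have vanish : ∀ n, j < 2 ^ n → ∀ i ≥ n, (if j.testBit i then q ^ (i + 1) else 0) = 0 := by
    intro n hn i hi
    simp [Nat.testBit_lt_two_pow (hn.trans_le (Nat.pow_le_pow_right two_pos hi))]
  rw [sqN, ← Finset.eventually_constant_sum (vanish j Nat.lt_two_pow_self) (le_max_left j m),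
    ← Finset.eventually_constant_sum (vanish m h) (le_max_right j m)]

theorem sqN_two_pow_add (q : ℝ) {j k : ℕ} (h : j < 2 ^ k) :
    sqN q (2 ^ k + j) = sqN q j + q ^ (k + 1) := by
  rw [sqN_eq_sum_range_of_lt_two_pow q (m := k + 1) (by rw [pow_succ]; omega),
    sqN_eq_sum_range_of_lt_two_pow q h, Finset.sum_range_succ, Nat.testBit_two_pow_add_eq,
    Nat.testBit_lt_two_pow h]
  congr 1
  refine Finset.sum_congr rfl fun i hi => ?_
  rw [Nat.testBit_two_pow_add_gt (Finset.mem_range.mp hi)]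

theorem Sq_two_pow_succ (q : ℝ) (k : ℕ) :
    Sq q (2 ^ (k + 1)) = 2 * Sq q (2 ^ k) + 2 ^ k * q ^ (k + 1) := by
  have upper : ∑ j ∈ Finset.range (2 ^ k), sqN q (2 ^ k + j) =
      ∑ j ∈ Finset.range (2 ^ k), (sqN q j + q ^ (k + 1)) :=
    Finset.sum_congr rfl fun j hj => sqN_two_pow_add q (Finset.mem_range.mp hj)
  rw [Sq, pow_succ, mul_two, Finset.sum_range_add, upper, Finset.sum_add_distrib]
  simp only [Sq, Finset.sum_const, Finset.card_range, nsmul_eq_mul]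
  push_cast
  ring

theorem Sq_two_pow_succ_eq_sum (q : ℝ) (k : ℕ) :
    Sq q (2 ^ (k + 1)) = 2 ^ k * ∑ i ∈ Finset.range (k + 1), q ^ (i + 1) := by
  induction k with
  | zero => simp [Sq, sqN, Finset.sum_range_succ]
  | succ k ih =>
    rw [Sq_two_pow_succ, ih, Finset.sum_range_succ _ (k + 1)]
    ring

theorem Sq_pow_two (q : ℝ) (k : ℕ) (hk : 1 ≤ k) :
    Sq q (2 ^ k) = (2 : ℝ) ^ (k - 1) * (∑ i ∈ Finset.Icc 1 k, q ^ i) ∧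
    (q ≠ 1 → Sq q (2 ^ k) = (2 : ℝ) ^ (k - 1) * q * (1 - q ^ k) / (1 - q)) := by
  obtain ⟨k, rfl⟩ := Nat.exists_eq_add_of_le' hk
  rw [Sq_two_pow_succ_eq_sum, Nat.add_sub_cancel]
  refine ⟨?_, fun hq => ?_⟩
  · rw [← Finset.Ico_add_one_right_eq_Icc, Finset.sum_Ico_eq_sum_range]
    simp [add_comm]
  · simp only [pow_succ q, ← Finset.sum_mul]
    rw [geom_sum_eq hq]
    have h₁ : q - 1 ≠ 0 := sub_ne_zero.mpr hq
    have h₂ : 1 - q ≠ 0 := sub_ne_zero.mpr hq.symm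
    field_simp
    ring

end
end
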